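/- Let 0 < h₀ < 1 and let Ω be the periodic channel of period L = 1 under a Lipschitz function h that equals h₀ on [3/8,1/2] ∪ [7/8,1] and equals 1 on [1/8,1/4] ∪ [5/8,3/4]. Let p be the piecewise linear function equal to −1 on the region under h with x ∈ [0,3/8], equal to +1 for x ∈ [1/2,7/8], with p_x = ±16 and p_y = 0 on the transition regions x ∈ [3/8,1/2] and x ∈ [7/8,1]. Then ‖∇p‖_{H⁻¹(Ω)} ≤ √8·h₀^{3/2}, while ‖p‖_{L²(Ω)} ≥ 1/2; hence the inf-sup constant satisfies β⁻¹ ≥ (2√8)⁻¹·h₀^{−3/2}. -/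

import Mathlib

open MeasureTheory Set

/-- The x-periodic channel `Ω = {(x,y) : x ∈ T, 0 < y < h(x)}` (period `1`). -/
def ChannelOmega (h : ℝ → ℝ) : Set (ℝ × ℝ) :=
  {p : ℝ × ℝ | p.1 ∈ Set.Ioo 0 1 ∧ p.2 ∈ Set.Ioo 0 (h p.1)}

/-- Test functions modeling `H¹₀(Ω)`: `C¹`, `1`-periodic in `x`, vanishing on
the bottom wall `y = 0` and the top wall `y = h(x)`. -/
def AdmChannel (h : ℝ → ℝ) (u : ℝ × ℝ → ℝ) : Prop :=
  ContDiff ℝ 1 u ∧ (∀ x y, u (x + 1, y) = u (x, y)) ∧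
    (∀ x, u (x, 0) = 0) ∧ (∀ x, u (x, h x) = 0)

/-- The squared energy (H¹ semi-)norm `‖∇u‖²_{L²(Ω)}`. -/
noncomputable def energyChannel (h : ℝ → ℝ) (u : ℝ × ℝ → ℝ) : ℝ :=
  ∫ p in ChannelOmega h, (fderiv ℝ u p (1, 0)) ^ 2 + (fderiv ℝ u p (0, 1)) ^ 2

/-- The continuous piecewise-linear pressure of Example 4.4: `−1` on
`[0,3/8]`, rising with slope `16` on `[3/8,1/2]`, `+1` on `[1/2,7/8]`, and
falling with slope `−16` on `[7/8,1]`; independent of `y`. -/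
noncomputable def Pexa (x : ℝ) : ℝ :=
  if x ≤ 3 / 8 then -1
  else if x ≤ 1 / 2 then -1 + 16 * (x - 3 / 8)
  else if x ≤ 7 / 8 then 1
  else 1 - 16 * (x - 7 / 8)

theorem continuous_Pexa : Continuous Pexa := by
  refine Continuous.if_le continuous_const (Continuous.if_le (by fun_prop)
    (Continuous.if_le continuous_const (by fun_prop) continuous_id continuous_const ?_)
    continuous_id continuous_const ?_) continuous_id continuous_const ?_
  · intro x hx
    have : x = 7 / 8 := hx
    subst this; norm_num
  · intro x hx
    have : x = 1 / 2 := hx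
    subst this; norm_num
  · intro x hx
    have : x = 3 / 8 := hx
    subst this; norm_num

theorem integrableOn_channelOmega {h : ℝ → ℝ} (hle : ∀ x, h x ≤ 1) {f : ℝ × ℝ → ℝ}
    (hf : Continuous f) : IntegrableOn f (ChannelOmega h) := by
  have hsub : ChannelOmega h ⊆ Icc 0 1 ×ˢ Icc 0 1 := by
    rintro ⟨x, y⟩ ⟨⟨hx0, hx1⟩, hy0, hy1⟩
    exact ⟨⟨hx0.le, hx1.le⟩, hy0.le, hy1.le.trans (hle x)⟩
  exact (hf.continuousOn.integrableOn_compact (isCompact_Icc.prod isCompact_Icc)).mono_set hsub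

/-- Fubini's theorem on the channel, for continuous integrands. -/
theorem integral_channelOmega {h : ℝ → ℝ} (hc : Continuous h) (hpos : ∀ x, 0 ≤ h x)
    (hle : ∀ x, h x ≤ 1) {f : ℝ × ℝ → ℝ} (hf : Continuous f) :
    ∫ z in ChannelOmega h, f z = ∫ x in (0 : ℝ)..1, ∫ y in (0 : ℝ)..h x, f (x, y) := by
  have hopen : MeasurableSet (ChannelOmega h) :=
    measurableSet_regionBetween measurable_const hc.measurable measurableSet_Ioo
  rw [← integral_indicator hopen, Measure.volume_eq_prod,
    integral_prod _ ((integrable_indicator_iff hopen).2 (integrableOn_channelOmega hle hf)),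
    intervalIntegral.integral_of_le zero_le_one, integral_Ioc_eq_integral_Ioo,
    ← integral_indicator measurableSet_Ioo]
  congr 1
  ext x
  by_cases hx : x ∈ Ioo (0 : ℝ) 1
  · rw [indicator_of_mem hx, intervalIntegral.integral_of_le (hpos x),
      integral_Ioc_eq_integral_Ioo, ← integral_indicator measurableSet_Ioo]
    congr 1
    ext y
    by_cases hy : y ∈ Ioo 0 (h x)
    · rw [indicator_of_mem hy, indicator_of_mem (show (x, y) ∈ ChannelOmega h from ⟨hx, hy⟩)]
    · rw [indicator_of_notMem hy, indicator_of_notMem fun hz : (x, y) ∈ ChannelOmega h => hy hz.2]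
  · rw [indicator_of_notMem hx]
    have : ∀ y, (ChannelOmega h).indicator f (x, y) = 0 := fun y =>
      indicator_of_notMem (fun hz : (x, y) ∈ ChannelOmega h => hx hz.1) _
    simp [this]

theorem hasDerivAt_fst_slice {u : ℝ × ℝ → ℝ} (hu : ContDiff ℝ 1 u) (x y : ℝ) :
    HasDerivAt (fun s => u (s, y)) (fderiv ℝ u (x, y) (1, 0)) x :=
  ((hu.differentiable one_ne_zero (x, y)).hasFDerivAt).comp_hasDerivAt x
    ((hasDerivAt_id x).prodMk (hasDerivAt_const x y))

theorem hasDerivAt_snd_slice {u : ℝ × ℝ → ℝ} (hu : ContDiff ℝ 1 u) (x y : ℝ) :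
    HasDerivAt (fun s => u (x, s)) (fderiv ℝ u (x, y) (0, 1)) y :=
  ((hu.differentiable one_ne_zero (x, y)).hasFDerivAt).comp_hasDerivAt y
    ((hasDerivAt_const y x).prodMk (hasDerivAt_id y))

theorem continuous_fderiv_apply_const {u : ℝ × ℝ → ℝ} (hu : ContDiff ℝ 1 u) (w : ℝ × ℝ) :
    Continuous fun z => fderiv ℝ u z w :=
  (hu.continuous_fderiv one_ne_zero).clm_apply continuous_const

theorem hasDerivAt_integral_slice {u : ℝ × ℝ → ℝ} (hu : ContDiff ℝ 1 u) (b x : ℝ) :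
    HasDerivAt (fun s => ∫ y in (0 : ℝ)..b, u (s, y))
      (∫ y in (0 : ℝ)..b, fderiv ℝ u (x, y) (1, 0)) x := by
  have hd := continuous_fderiv_apply_const hu (1, 0)
  have hcu := hu.continuous
  obtain ⟨C, hC⟩ := ((isCompact_closedBall x 1).prod (isCompact_uIcc (a := (0 : ℝ)) (b := b))
    ).exists_bound_of_continuousOn hd.continuousOn
  refine (intervalIntegral.hasDerivAt_integral_of_dominated_loc_of_deriv_le
    (F := fun s y => u (s, y)) (F' := fun s y => fderiv ℝ u (s, y) (1, 0)) (bound := fun _ => C)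
    (Metric.closedBall_mem_nhds x one_pos) (.of_forall fun s => ?_) ?_ ?_ ?_ ?_ ?_).2
  · exact (by fun_prop : Continuous fun y => u (s, y)).aestronglyMeasurable
  · exact (by fun_prop : Continuous fun y => u (x, y)).intervalIntegrable _ _
  · exact (hd.comp (by fun_prop : Continuous fun y : ℝ => (x, y))).aestronglyMeasurable
  · exact .of_forall fun y hy s hs => hC (s, y) ⟨hs, uIoc_subset_uIcc hy⟩
  · exact intervalIntegrable_const
  · exact .of_forall fun y _ s _ => hasDerivAt_fst_slice hu s y

/-- Leibniz rule under a Lipschitz graph on which the integrand vanishes: no boundary term, and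
no differentiability of the graph is needed. -/
theorem hasDerivAt_integral_under_graph {h : ℝ → ℝ} {K : NNReal} (hlip : LipschitzWith K h)
    {u : ℝ × ℝ → ℝ} (hu : ContDiff ℝ 1 u) (x : ℝ) (hx : u (x, h x) = 0) :
    HasDerivAt (fun s => ∫ y in (0 : ℝ)..h s, u (s, y))
      (∫ y in (0 : ℝ)..h x, fderiv ℝ u (x, y) (1, 0)) x := by
  have hcu := hu.continuous
  have hi : ∀ s a b, IntervalIntegrable (fun y => u (s, y)) volume a b := fun s a b =>
    (by fun_prop : Continuous fun y => u (s, y)).intervalIntegrable _ _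
  have hsplit : (fun s => ∫ y in (0 : ℝ)..h s, u (s, y)) =
      (fun s => ∫ y in (0 : ℝ)..h x, u (s, y)) + fun s => ∫ y in h x..h s, u (s, y) := by
    ext s
    exact (intervalIntegral.integral_add_adjacent_intervals (hi _ _ _) (hi _ _ _)).symm
  rw [hsplit, ← add_zero (∫ y in (0 : ℝ)..h x, fderiv ℝ u (x, y) (1, 0))]
  refine (hasDerivAt_integral_slice hu (h x) x).add ?_
  rw [hasDerivAt_iff_isLittleO]
  simp only [intervalIntegral.integral_same, sub_zero, smul_zero]
  refine Asymptotics.IsLittleO.of_bound fun c hc => ?_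
  have hK : (0 : ℝ) < K + 1 := by positivity
  obtain ⟨δ, hδ, hball⟩ := Metric.continuousAt_iff.1 (hcu.continuousAt (x := (x, h x)))
    (c / (K + 1)) (by positivity)
  filter_upwards [Metric.ball_mem_nhds x (show 0 < δ / (K + 1) by positivity)] with s hs
  rw [Metric.mem_ball, lt_div_iff₀ hK] at hs
  have hd0 : 0 ≤ dist s x := dist_nonneg
  have hK0 : (0 : ℝ) ≤ K := K.2
  have hls := hlip.dist_le_mul s x
  have hbound : ∀ y ∈ uIoc (h x) (h s), ‖u (s, y)‖ ≤ c / (K + 1) := by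
    intro y hy
    have hy' : dist y (h x) ≤ dist (h s) (h x) := by
      rw [Real.dist_eq, Real.dist_eq]
      exact abs_sub_left_of_mem_uIcc (uIoc_subset_uIcc hy)
    have := hball (x := (s, y)) (by
      rw [Prod.dist_eq]
      exact max_lt (by nlinarith) (by nlinarith))
    rw [hx, dist_zero_right] at this
    exact this.le
  refine (intervalIntegral.norm_integral_le_of_norm_le_const hbound).trans ?_
  rw [← Real.dist_eq, ← dist_eq_norm, div_mul_eq_mul_div, div_le_iff₀ hK]
  nlinarith [mul_nonneg hc.le hd0]

/-- Integration by parts against the pressure profile. -/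
theorem integral_Pexa_mul_deriv {U U' : ℝ → ℝ} (hU : ∀ x, HasDerivAt U (U' x) x)
    (hU' : Continuous U') (hper : U 1 = U 0) :
    ∫ x in (0 : ℝ)..1, Pexa x * U' x =
      16 * ((∫ x in (7 / 8 : ℝ)..1, U x) - ∫ x in (3 / 8 : ℝ)..(1 / 2), U x) := by
  have hi : ∀ a b, IntervalIntegrable (fun x => Pexa x * U' x) volume a b := fun a b =>
    (continuous_Pexa.mul hU').intervalIntegrable a b
  have key : ∀ a b c d : ℝ, a ≤ b → (∀ x ∈ Icc a b, Pexa x = c * x + d) →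
      ∫ x in a..b, Pexa x * U' x =
        (c * b + d) * U b - (c * a + d) * U a - c * ∫ x in a..b, U x := by
    intro a b c d hab hP
    rw [← intervalIntegral.integral_const_mul,
      ← intervalIntegral.integral_mul_deriv_eq_deriv_mul (u := fun x => c * x + d)
        (u' := fun _ => c) (fun x _ => ?_) (fun x _ => hU x) intervalIntegrable_const
        (hU'.intervalIntegrable a b)]
    · refine intervalIntegral.integral_congr fun x hx => ?_
      rw [uIcc_of_le hab] at hx
      simp only [hP x hx]
    · simpa using ((hasDerivAt_id x).const_mul c).add_const d
  rw [← intervalIntegral.integral_add_adjacent_intervals (hi 0 (7 / 8)) (hi _ 1),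
    ← intervalIntegral.integral_add_adjacent_intervals (hi 0 (1 / 2)) (hi _ (7 / 8)),
    ← intervalIntegral.integral_add_adjacent_intervals (hi 0 (3 / 8)) (hi _ (1 / 2)),
    key 0 (3 / 8) 0 (-1), key (3 / 8) (1 / 2) 16 (-7), key (1 / 2) (7 / 8) 0 1,
    key (7 / 8) 1 (-16) 15, hper]
  · ring
  all_goals try norm_num
  all_goals
    intro x h1 h2
    unfold Pexa
    split_ifs <;> linarith

/-- A quadratic form of the estimate `(∫ w)² ≤ b³/12 ∫ w'²` for `w` vanishing at `0` and `b`. -/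
theorem two_mul_integral_le {w w' : ℝ → ℝ} (hw : ∀ y, HasDerivAt w (w' y) y)
    (hw' : Continuous w') {b : ℝ} (hb : 0 ≤ b) (h0 : w 0 = 0) (hwb : w b = 0) (t : ℝ) :
    2 * t * ∫ y in (0 : ℝ)..b, w y ≤ (∫ y in (0 : ℝ)..b, w' y ^ 2) + t ^ 2 * (b ^ 3 / 12) := by
  have hparts : ∫ y in (0 : ℝ)..b, (y - b / 2) * w' y = -∫ y in (0 : ℝ)..b, w y := by
    rw [intervalIntegral.integral_mul_deriv_eq_deriv_mul (u := fun y => y - b / 2)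
      (u' := fun _ => 1) (fun y _ => (hasDerivAt_id y).sub_const _) (fun y _ => hw y)
      intervalIntegrable_const (hw'.intervalIntegrable _ _)]
    simp [h0, hwb]
  have hsq : ∫ y in (0 : ℝ)..b, (y - b / 2) ^ 2 = b ^ 3 / 12 := by
    rw [intervalIntegral.integral_comp_sub_right (fun y => y ^ 2), integral_pow]
    ring
  have hnn : 0 ≤ ∫ y in (0 : ℝ)..b, (w' y + t * (y - b / 2)) ^ 2 :=
    intervalIntegral.integral_nonneg hb fun y _ => sq_nonneg _
  have hexp : ∫ y in (0 : ℝ)..b, (w' y + t * (y - b / 2)) ^ 2 =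
      (∫ y in (0 : ℝ)..b, w' y ^ 2) + 2 * t * (∫ y in (0 : ℝ)..b, (y - b / 2) * w' y) +
        t ^ 2 * ∫ y in (0 : ℝ)..b, (y - b / 2) ^ 2 := by
    rw [← intervalIntegral.integral_const_mul, ← intervalIntegral.integral_const_mul,
      ← intervalIntegral.integral_add, ← intervalIntegral.integral_add]
    · exact intervalIntegral.integral_congr fun y _ => by ring
    all_goals exact Continuous.intervalIntegrable (by fun_prop) _ _
  rw [hexp, hparts, hsq] at hnn
  linarith

theorem integral_nonneg_split {G : ℝ → ℝ} (hG : Continuous G) (hG0 : ∀ x, 0 ≤ G x) {a b c d : ℝ}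
    (ha : 0 ≤ a) (hab : a ≤ b) (hbc : b ≤ c) (hcd : c ≤ d) (hd : d ≤ 1) :
    (∫ x in a..b, G x) + (∫ x in c..d, G x) ≤ ∫ x in (0 : ℝ)..1, G x := by
  have hi : ∀ a b, IntervalIntegrable G volume a b := fun a b => hG.intervalIntegrable a b
  have h1 := intervalIntegral.integral_mono_interval (μ := volume) ha hab hbc
    (.of_forall hG0) (hi 0 c)
  have h2 := intervalIntegral.integral_mono_interval (μ := volume) le_rfl hcd hd
    (.of_forall hG0) (hi c 1)
  have h3 := intervalIntegral.integral_add_adjacent_intervals (hi 0 c) (hi c 1)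
  linarith

theorem integral_channelOmega_Pexa_mul_fderiv_snd {h : ℝ → ℝ} (hc : Continuous h)
    (hpos : ∀ x, 0 ≤ h x) (hle : ∀ x, h x ≤ 1) {v : ℝ × ℝ → ℝ} (hv : AdmChannel h v) :
    ∫ z in ChannelOmega h, Pexa z.1 * fderiv ℝ v z (0, 1) = 0 := by
  obtain ⟨hv1, -, hv0, hvh⟩ := hv
  have hd := continuous_fderiv_apply_const hv1 (0, 1)
  rw [integral_channelOmega hc hpos hle (f := fun z => Pexa z.1 * fderiv ℝ v z (0, 1))
    ((continuous_Pexa.comp continuous_fst).mul hd)]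
  have : ∀ x, ∫ y in (0 : ℝ)..h x, Pexa x * fderiv ℝ v (x, y) (0, 1) = 0 := by
    intro x
    rw [intervalIntegral.integral_const_mul,
      intervalIntegral.integral_eq_sub_of_hasDerivAt (fun y _ => hasDerivAt_snd_slice hv1 x y)
        ((hd.comp (by fun_prop : Continuous fun y : ℝ => (x, y))).intervalIntegrable _ _),
      hv0, hvh, sub_zero, mul_zero]
  simp [this]

theorem sq_integral_channelOmega_Pexa_mul_fderiv_fst_le {h₀ : ℝ} (hh₀ : 0 < h₀) {h : ℝ → ℝ}
    {K : NNReal} (hlip : LipschitzWith K h) (hperh : ∀ x, h (x + 1) = h x)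
    (hlow : ∀ x, h₀ ≤ h x) (hhigh : ∀ x, h x ≤ 1)
    (hflat : ∀ x ∈ Icc (3 / 8 : ℝ) (1 / 2) ∪ Icc (7 / 8 : ℝ) 1, h x = h₀)
    {u : ℝ × ℝ → ℝ} (hu : AdmChannel h u) :
    (∫ z in ChannelOmega h, Pexa z.1 * fderiv ℝ u z (1, 0)) ^ 2 ≤
      8 * h₀ ^ 3 * energyChannel h u := by
  obtain ⟨hu1, hup, hu0, huh⟩ := hu
  have hc := hlip.continuous
  have hpos : ∀ x, 0 ≤ h x := fun x => hh₀.le.trans (hlow x)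
  have hdx := continuous_fderiv_apply_const hu1 (1, 0)
  have hdy := continuous_fderiv_apply_const hu1 (0, 1)
  set U : ℝ → ℝ := fun x => ∫ y in (0 : ℝ)..h x, u (x, y) with hUdef
  have hU : ∀ x, HasDerivAt U (∫ y in (0 : ℝ)..h x, fderiv ℝ u (x, y) (1, 0)) x := fun x =>
    hasDerivAt_integral_under_graph hlip hu1 x (huh x)
  have hUc : Continuous U := continuous_iff_continuousAt.2 fun x => (hU x).continuousAt
  have hgraph : ∀ f : ℝ × ℝ → ℝ, Continuous f →
      Continuous fun x => ∫ y in (0 : ℝ)..h x, f (x, y) := fun f hf =>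
    intervalIntegral.continuous_parametric_intervalIntegral_of_continuous
      (f := fun x y => f (x, y)) hf hc
  have hU10 : U 1 = U 0 := by
    have h10 : h 1 = h 0 := by simpa using hperh 0
    have : ∀ y, u (1, y) = u (0, y) := fun y => by simpa using hup 0 y
    simp only [hUdef, h10, this]
  have hA : ∫ z in ChannelOmega h, Pexa z.1 * fderiv ℝ u z (1, 0) =
      16 * ((∫ x in (7 / 8 : ℝ)..1, U x) - ∫ x in (3 / 8 : ℝ)..(1 / 2), U x) := by
    rw [integral_channelOmega hc hpos hhigh (f := fun z => Pexa z.1 * fderiv ℝ u z (1, 0))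
        ((continuous_Pexa.comp continuous_fst).mul hdx),
      ← integral_Pexa_mul_deriv hU (hgraph _ hdx) hU10]
    simp only [intervalIntegral.integral_const_mul]
  set G : ℝ → ℝ := fun x => ∫ y in (0 : ℝ)..h x,
    ((fderiv ℝ u (x, y) (1, 0)) ^ 2 + (fderiv ℝ u (x, y) (0, 1)) ^ 2)
  have hGc : Continuous G := hgraph _ ((hdx.pow 2).add (hdy.pow 2))
  have hE : energyChannel h u = ∫ x in (0 : ℝ)..1, G x :=
    integral_channelOmega hc hpos hhigh ((hdx.pow 2).add (hdy.pow 2))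
  have hG0 : ∀ x, 0 ≤ G x := fun x =>
    intervalIntegral.integral_nonneg (hpos x) fun y _ => by positivity
  have hcol : ∀ x, h x = h₀ → ∀ t, 2 * t * U x ≤ G x + t ^ 2 * (h₀ ^ 3 / 12) := by
    intro x hx t
    have hline : Continuous fun y : ℝ => (x, y) := by fun_prop
    have h1 := two_mul_integral_le (hasDerivAt_snd_slice hu1 x) (hdy.comp hline) (hpos x)
      (hu0 x) (huh x) t
    have h2 : ∫ y in (0 : ℝ)..h x, (fderiv ℝ u (x, y) (0, 1)) ^ 2 ≤ G x :=
      intervalIntegral.integral_mono (hpos x)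
        (((hdy.comp hline).pow 2).intervalIntegrable _ _)
        ((((hdx.comp hline).pow 2).add ((hdy.comp hline).pow 2)).intervalIntegrable _ _)
        fun y => le_add_of_nonneg_left (sq_nonneg _)
    rw [← hx]
    exact h1.trans (add_le_add_left h2 _)
  have hstrip : ∀ a b : ℝ, a ≤ b → (∀ x ∈ Icc a b, h x = h₀) → ∀ t,
      2 * t * (∫ x in a..b, U x) ≤ (∫ x in a..b, G x) + (b - a) * (t ^ 2 * (h₀ ^ 3 / 12)) := by
    intro a b hab hx t
    have := intervalIntegral.integral_mono_on hab
      ((hUc.const_mul (2 * t)).intervalIntegrable (μ := volume) a b)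
      (Continuous.intervalIntegrable (u := fun x => G x + t ^ 2 * (h₀ ^ 3 / 12)) (by fun_prop) a b)
      fun x hxx => hcol x (hx x hxx) t
    rwa [intervalIntegral.integral_const_mul, intervalIntegral.integral_add
      (hGc.intervalIntegrable a b) intervalIntegrable_const, intervalIntegral.integral_const,
      smul_eq_mul] at this
  have hsplit := integral_nonneg_split hGc hG0 (a := 3 / 8) (b := 1 / 2) (c := 7 / 8) (d := 1)
    (by norm_num) (by norm_num) (by norm_num) (by norm_num) le_rfl
  have hE0 : 0 ≤ ∫ x in (0 : ℝ)..1, G x :=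
    intervalIntegral.integral_nonneg zero_le_one fun x _ => hG0 x
  rw [hA, hE]
  set p := ∫ x in (7 / 8 : ℝ)..1, U x
  set q := ∫ x in (3 / 8 : ℝ)..(1 / 2), U x
  set E := ∫ x in (0 : ℝ)..1, G x
  have hdisc := discrim_le_zero (a := h₀ ^ 3 / 48) (b := -(2 * (p - q))) (c := E) fun t => by
    have h1 := hstrip (7 / 8) 1 (by norm_num) (fun x hx => hflat x (Or.inr hx)) t
    have h2 := hstrip (3 / 8) (1 / 2) (by norm_num) (fun x hx => hflat x (Or.inl hx)) (-t)
    linarith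
  rw [discrim] at hdisc
  nlinarith [mul_nonneg (pow_pos hh₀ 3).le hE0]

theorem quarter_le_integral_Pexa_sq {h : ℝ → ℝ} (hc : Continuous h) (hpos : ∀ x, 0 ≤ h x)
    (hle : ∀ x, h x ≤ 1)
    (htall : ∀ x ∈ Icc (1 / 8 : ℝ) (1 / 4) ∪ Icc (5 / 8 : ℝ) (3 / 4), h x = 1) :
    (1 / 4 : ℝ) ≤ ∫ z in ChannelOmega h, (Pexa z.1) ^ 2 := by
  rw [integral_channelOmega hc hpos hle (f := fun z => Pexa z.1 ^ 2)
    ((continuous_Pexa.comp continuous_fst).pow 2)]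
  simp only [intervalIntegral.integral_const, sub_zero, smul_eq_mul]
  have hone : ∀ a b : ℝ, a ≤ b → (∀ x ∈ Icc a b, h x * Pexa x ^ 2 = 1) →
      ∫ x in a..b, h x * Pexa x ^ 2 = b - a := by
    intro a b hab hx
    rw [intervalIntegral.integral_congr (g := fun _ => 1) (by rwa [EqOn, uIcc_of_le hab])]
    simp
  have hsplit := integral_nonneg_split (G := fun x => h x * Pexa x ^ 2)
    (hc.mul (continuous_Pexa.pow 2))
    (fun x => mul_nonneg (hpos x) (sq_nonneg _))
    (a := 1 / 8) (b := 1 / 4) (c := 5 / 8) (d := 3 / 4)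
    (by norm_num) (by norm_num) (by norm_num) (by norm_num) (by norm_num)
  rw [hone (1 / 8) (1 / 4) (by norm_num) fun x hx => ?_,
    hone (5 / 8) (3 / 4) (by norm_num) fun x hx => ?_] at hsplit
  · linarith
  · have : Pexa x = 1 := by
      have := hx.1
      have := hx.2
      unfold Pexa
      split_ifs <;> linarith
    rw [htall x (Or.inr hx), this]; norm_num
  · have : Pexa x = -1 := if_pos (by linarith [hx.2])
    rw [htall x (Or.inl hx), this]; norm_num

/-- Example 4.4 (optimality of `h₀^{−3/2}`): with `0 < h₀ < 1` and a periodic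
Lipschitz `h` equal to `h₀` on `[3/8,1/2] ∪ [7/8,1]` and to `1` on
`[1/8,1/4] ∪ [5/8,3/4]`, the pressure `p(x,y) = Pexa x` satisfies
`|⟨∇p,(u,v)⟩| ≤ √8 h₀^{3/2} ‖(u,v)‖_a` for all test fields, i.e.
`‖∇p‖_{H⁻¹} ≤ √8 h₀^{3/2}`, while `‖p‖²_{L²(Ω)} ≥ 1/4`. -/
theorem example_optimal_h0 (h₀ : ℝ) (hh₀ : 0 < h₀) (hh₀1 : h₀ < 1)
    (h : ℝ → ℝ) (K : NNReal) (hlip : LipschitzWith K h)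
    (hperh : ∀ x, h (x + 1) = h x)
    (hlow : ∀ x, h₀ ≤ h x) (hhigh : ∀ x, h x ≤ 1)
    (hflat : ∀ x ∈ Set.Icc (3/8 : ℝ) (1/2) ∪ Set.Icc (7/8 : ℝ) 1, h x = h₀)
    (htall : ∀ x ∈ Set.Icc (1/8 : ℝ) (1/4) ∪ Set.Icc (5/8 : ℝ) (3/4), h x = 1) :
    (∀ u v : ℝ × ℝ → ℝ, AdmChannel h u → AdmChannel h v →
      |∫ z in ChannelOmega h,
          Pexa z.1 * ((fderiv ℝ u z (1, 0)) + (fderiv ℝ v z (0, 1)))|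
        ≤ Real.sqrt 8 * Real.sqrt (h₀ ^ 3) *
            Real.sqrt (energyChannel h u + energyChannel h v))
    ∧ (1 / 4 : ℝ) ≤ ∫ z in ChannelOmega h, (Pexa z.1) ^ 2 := by
  have hc := hlip.continuous
  have hpos : ∀ x, 0 ≤ h x := fun x => hh₀.le.trans (hlow x)
  refine ⟨fun u v hu hv => ?_, quarter_le_integral_Pexa_sq hc hpos hhigh htall⟩
  have hP : Continuous fun z : ℝ × ℝ => Pexa z.1 := continuous_Pexa.comp continuous_fst
  have hsum : ∫ z in ChannelOmega h, Pexa z.1 * (fderiv ℝ u z (1, 0) + fderiv ℝ v z (0, 1)) =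
      ∫ z in ChannelOmega h, Pexa z.1 * fderiv ℝ u z (1, 0) := by
    simp only [mul_add]
    rw [integral_add (f := fun z => Pexa z.1 * fderiv ℝ u z (1, 0))
      (g := fun z => Pexa z.1 * fderiv ℝ v z (0, 1))
      (integrableOn_channelOmega hhigh (hP.mul (continuous_fderiv_apply_const hu.1 (1, 0))))
      (integrableOn_channelOmega hhigh (hP.mul (continuous_fderiv_apply_const hv.1 (0, 1)))),
      integral_channelOmega_Pexa_mul_fderiv_snd hc hpos hhigh hv, add_zero]
  have hEv : 0 ≤ energyChannel h v := integral_nonneg fun z => by positivity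
  rw [hsum, ← Real.sqrt_mul (by norm_num), ← Real.sqrt_mul (by positivity)]
  refine Real.abs_le_sqrt ((sq_integral_channelOmega_Pexa_mul_fderiv_fst_le hh₀ hlip hperh hlow
    hhigh hflat hu).trans ?_)
  gcongr
  exact le_add_of_nonneg_right hEv
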